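/- Let W : ℝ^d → ℝ satisfy: W(−x) = W(x) for all x, W(0) = 0, W is C¹ on ℝ^d \ {0}, and x ↦ W(x) − (λ/2)|x|² is convex for some λ > 0. Let μ and μ' be compactly supported probability measures on ℝ^d, let Z and Z' be characteristic flows for the aggregation equation with potential W and initial measures μ and μ' respectively, and assume there exists R ≥ 0 such that |Z(t,x)| ≤ R for all t ≥ 0 and all x in the support of μ, and |Z'(t,y)| ≤ R for all t ≥ 0 and all y in the support of μ'. Then for every coupling π of μ and μ', the function t ↦ ∬_{ℝ^d×ℝ^d} |Z(t,x) − Z'(t,y)|² π(dx,dy) is non-increasing on [0,∞); in particular ∬ |Z(t,x) − Z'(t,y)|² π(dx,dy) ≤ ∬ |x − y|² π(dx,dy) for all t ≥ 0, and hence d_W(Z(t,·)_#μ, Z'(t,·)_#μ') ≤ d_W(μ, μ'). -/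

import Mathlib

open MeasureTheory Real Set
open scoped RealInnerProductSpace ENNReal

noncomputable section

/-- `ℝ^d` with the Euclidean structure. -/
abbrev Euc (d : ℕ) := EuclideanSpace ℝ (Fin d)

open Classical in
/-- `∇̂W`: the gradient of `W` away from `0`, and `0` at `0`. -/
def hatGrad {d : ℕ} (W : Euc d → ℝ) (x : Euc d) : Euc d :=
  if x = 0 then 0 else gradient W x

/-- `Z` is a characteristic flow for the aggregation equation with potential `W`
and initial measure `μ`. -/
def IsCharFlow {d : ℕ} (W : Euc d → ℝ) (μ : Measure (Euc d)) (Z : ℝ → Euc d → Euc d) : Prop :=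
  (∀ x, Z 0 x = x) ∧
  ∀ t : ℝ, 0 ≤ t → ∀ x,
    Z t x = x - ∫ s in (0:ℝ)..t, ∫ x', hatGrad W (Z s x - Z s x') ∂μ

/-- `γ` is a coupling of `μ` and `ν`. -/
def IsCoupling {d : ℕ} (γ : Measure (Euc d × Euc d)) (μ ν : Measure (Euc d)) : Prop :=
  IsProbabilityMeasure γ ∧ γ.map Prod.fst = μ ∧ γ.map Prod.snd = ν

/-- The quadratic Wasserstein distance. -/
def wDist {d : ℕ} (μ ν : Measure (Euc d)) : ℝ :=
  Real.sqrt (sInf {r : ℝ | ∃ γ : Measure (Euc d × Euc d),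
    IsCoupling γ μ ν ∧ r = ∫ p, ‖p.1 - p.2‖ ^ 2 ∂γ})

/-- The support of a measure: points all of whose neighborhoods have positive measure. -/
def msupport {d : ℕ} (μ : Measure (Euc d)) : Set (Euc d) := {x | ∀ U ∈ nhds x, 0 < μ U}

/-- The subgradient inequality for a convex function at a point of differentiability. -/
lemma inner_gradient_le_sub {d : ℕ} {W : Euc d → ℝ} (hW : ConvexOn ℝ univ W) {x : Euc d}
    (hx : DifferentiableAt ℝ W x) (y : Euc d) : ⟪gradient W x, y - x⟫ ≤ W y - W x := by
  have hline : ConvexOn ℝ univ (fun t : ℝ => W (AffineMap.lineMap x y t)) :=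
    hW.comp_affineMap (AffineMap.lineMap x y)
  have hd : HasDerivAt (fun t : ℝ => W (AffineMap.lineMap x y t))
      (⟪gradient W x, y - x⟫) 0 := by
    have h1 : HasFDerivAt W (InnerProductSpace.toDual ℝ _ (gradient W x))
        (AffineMap.lineMap x y (0 : ℝ)) := by
      rw [AffineMap.lineMap_apply_zero]
      exact hx.hasGradientAt
    have h2 : HasDerivAt (fun t : ℝ => AffineMap.lineMap x y t) (y - x) (0 : ℝ) :=
      AffineMap.hasDerivAt_lineMap
    exact h1.comp_hasDerivAt (0 : ℝ) h2
  have := hline.le_slope_of_hasDerivAt (mem_univ 0) (mem_univ 1) one_pos hd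
  simpa [slope] using this

/-- `hatGrad W` selects a subgradient everywhere if `W` is even, convex, and differentiable
away from the origin. -/
lemma inner_hatGrad_le_sub {d : ℕ} {W : Euc d → ℝ} (hW : ConvexOn ℝ univ W)
    (hsymm : ∀ x, W (-x) = W x) (hdiff : ∀ x, x ≠ 0 → DifferentiableAt ℝ W x) (x y : Euc d) :
    ⟪hatGrad W x, y - x⟫ ≤ W y - W x := by
  by_cases hx : x = 0
  · have h := hW.2 (mem_univ y) (mem_univ (-y)) (by norm_num : (0 : ℝ) ≤ 1 / 2)
      (by norm_num : (0 : ℝ) ≤ 1 / 2) (by norm_num)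
    simp only [hsymm, smul_neg, add_neg_cancel, smul_eq_mul] at h
    simp only [hatGrad, hx, if_true, inner_zero_left]
    linarith
  · simpa [hatGrad, hx] using inner_gradient_le_sub hW (hdiff x hx) y

lemma inner_hatGrad_sub_nonneg {d : ℕ} {W : Euc d → ℝ} (hW : ConvexOn ℝ univ W)
    (hsymm : ∀ x, W (-x) = W x) (hdiff : ∀ x, x ≠ 0 → DifferentiableAt ℝ W x) (x y : Euc d) :
    0 ≤ ⟪x - y, hatGrad W x - hatGrad W y⟫ := by
  have h1 := inner_hatGrad_le_sub hW hsymm hdiff x y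
  have h2 := inner_hatGrad_le_sub hW hsymm hdiff y x
  have h3 : ⟪x - y, hatGrad W x - hatGrad W y⟫
      = -(⟪hatGrad W x, y - x⟫ + ⟪hatGrad W y, x - y⟫) := by
    simp only [inner_sub_left, inner_sub_right, real_inner_comm]
    ring
  linarith

lemma hatGrad_neg {d : ℕ} {W : Euc d → ℝ} (hsymm : ∀ x, W (-x) = W x) (x : Euc d) :
    hatGrad W (-x) = -hatGrad W x := by
  by_cases hx : x = 0
  · simp [hatGrad, hx]
  · have h : fderiv ℝ W (-x) = -fderiv ℝ W x := by
      have h1 : (fun y => W (-y)) = W := funext hsymm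
      have h2 := fderiv_comp_smul (𝕜 := ℝ) (f := W) (x := x) (-1)
      simp only [neg_one_smul, h1] at h2
      rw [h2, neg_neg]
    simp [hatGrad, hx, gradient, h]

lemma measurable_hatGrad {d : ℕ} (W : Euc d → ℝ) : Measurable (hatGrad W) := by
  have h : Measurable (gradient W) :=
    (InnerProductSpace.toDual ℝ (Euc d)).symm.continuous.measurable.comp (measurable_fderiv ℝ W)
  exact Measurable.ite (measurableSet_singleton (0 : Euc d)) measurable_const h

lemma exists_norm_hatGrad_le {d : ℕ} {W : Euc d → ℝ} (hW : ConvexOn ℝ univ W)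
    (hsymm : ∀ x, W (-x) = W x) (hdiff : ∀ x, x ≠ 0 → DifferentiableAt ℝ W x) (r : ℝ) :
    ∃ C : ℝ, 0 ≤ C ∧ ∀ x, ‖x‖ ≤ r → ‖hatGrad W x‖ ≤ C := by
  have hcont : Continuous W := hW.locallyLipschitz.continuous
  obtain ⟨M, hM⟩ := (isCompact_closedBall (0 : Euc d) (r + 1)).exists_bound_of_continuousOn
    hcont.continuousOn
  refine ⟨max (2 * M) 0, le_max_right _ _, fun x hx => ?_⟩
  by_cases hg : hatGrad W x = 0
  · simp [hg]
  set g := hatGrad W x with hgdef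
  have hgpos : 0 < ‖g‖ := norm_pos_iff.2 hg
  have hu : ‖(‖g‖⁻¹ : ℝ) • g‖ = 1 := by
    rw [norm_smul, norm_inv, norm_norm, inv_mul_cancel₀ hgpos.ne']
  have h := inner_hatGrad_le_sub hW hsymm hdiff x (x + (‖g‖⁻¹ : ℝ) • g)
  rw [← hgdef, add_sub_cancel_left, inner_smul_right, real_inner_self_eq_norm_sq, sq,
    inv_mul_cancel_left₀ hgpos.ne'] at h
  have h1 := hM x (by simpa using hx.trans (by linarith))
  have h2 := hM (x + (‖g‖⁻¹ : ℝ) • g) (by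
    rw [mem_closedBall_zero_iff]
    exact (norm_add_le _ _).trans (by rw [hu]; linarith))
  rw [Real.norm_eq_abs] at h1 h2
  exact le_max_of_le_left (by linarith [neg_abs_le (W x), le_abs_self (W (x + (‖g‖⁻¹ : ℝ) • g))])

lemma ae_mem_msupport {d : ℕ} (μ : Measure (Euc d)) : ∀ᵐ x ∂μ, x ∈ msupport μ := by
  filter_upwards [Measure.support_mem_ae (μ := μ)] with x hx
  exact (Measure.mem_support_iff_forall x).1 hx

lemma antitoneOn_Ici_of_sub_le_sq {E : ℝ → ℝ} {K : ℝ}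
    (h : ∀ s t, 0 ≤ s → s ≤ t → E t - E s ≤ K * (t - s) ^ 2) : AntitoneOn E (Ici 0) := by
  intro s hs t _ hst
  have hs0 : (0 : ℝ) ≤ s := hs
  have key : ∀ n : ℕ, E t ≤ E s + K * (t - s) ^ 2 * (1 / ((n : ℝ) + 1)) := by
    intro n
    set δ : ℝ := (t - s) / ((n : ℝ) + 1) with hδ
    have hn : (0 : ℝ) < (n : ℝ) + 1 := by positivity
    have hδ0 : 0 ≤ δ := div_nonneg (by linarith) hn.le
    have step : ∀ k : ℕ, E (s + k * δ) ≤ E s + k * (K * δ ^ 2) := by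
      intro k
      induction k with
      | zero => simp
      | succ k ih =>
        have := h (s + k * δ) (s + (k + 1 : ℕ) * δ) (by positivity)
          (by push_cast; nlinarith)
        have e : s + (k + 1 : ℕ) * δ - (s + k * δ) = δ := by push_cast; ring
        rw [e] at this
        push_cast at this ⊢
        linarith
    have hfin := step (n + 1)
    have e1 : s + ((n + 1 : ℕ) : ℝ) * δ = t := by
      push_cast
      rw [hδ]
      field_simp
      ring
    have e2 : ((n + 1 : ℕ) : ℝ) * (K * δ ^ 2) = K * (t - s) ^ 2 * (1 / ((n : ℝ) + 1)) := by
      push_cast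
      rw [hδ]
      field_simp
    rwa [e1, e2] at hfin
  have hlim : Filter.Tendsto (fun n : ℕ => E s + K * (t - s) ^ 2 * (1 / ((n : ℝ) + 1)))
      Filter.atTop (nhds (E s + K * (t - s) ^ 2 * 0)) :=
    (tendsto_one_div_add_atTop_nhds_zero_nat.const_mul _).const_add _
  simpa using ge_of_tendsto' hlim key

/-- Pairing an odd monotone interaction with the displacement gives a nonnegative double
integral, by symmetrization. -/
lemma integral_inner_interaction_nonneg {d : ℕ} {Ω : Type*} [MeasurableSpace Ω] (P : Measure Ω)
    [IsProbabilityMeasure P] {H : Euc d → Euc d} (hH : Measurable H)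
    (hodd : ∀ x, H (-x) = -H x) (hmono : ∀ x y, 0 ≤ ⟪x - y, H x - H y⟫) {C R : ℝ}
    (hC : ∀ x, ‖x‖ ≤ 2 * R → ‖H x‖ ≤ C) {a b : Ω → Euc d} (ha : Measurable a)
    (hb : Measurable b) (haR : ∀ p, ‖a p‖ ≤ R) (hbR : ∀ p, ‖b p‖ ≤ R) :
    0 ≤ ∫ p, ⟪a p - b p, (∫ q, H (a p - a q) ∂P) - ∫ q, H (b p - b q) ∂P⟫ ∂P := by
  have hbd : ∀ {c : Ω → Euc d}, (∀ p, ‖c p‖ ≤ R) → ∀ p q, ‖H (c p - c q)‖ ≤ C := fun hc p q =>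
    hC _ ((norm_sub_le _ _).trans (by linarith [hc p, hc q]))
  have hint : ∀ {c : Ω → Euc d}, Measurable c → (∀ p, ‖c p‖ ≤ R) → ∀ p,
      Integrable (fun q => H (c p - c q)) P := fun hcm hc p =>
    Integrable.of_bound (hH.comp (measurable_const.sub hcm)).aestronglyMeasurable C
      (ae_of_all _ fun q => hbd hc p q)
  set G : Ω → Ω → Euc d := fun p q => H (a p - a q) - H (b p - b q) with hG
  have hGint : ∀ p, Integrable (G p) P := fun p => (hint ha haR p).sub (hint hb hbR p)
  have hinner : ∀ p, ⟪a p - b p, (∫ q, H (a p - a q) ∂P) - ∫ q, H (b p - b q) ∂P⟫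
      = ∫ q, ⟪a p - b p, G p q⟫ ∂P := by
    intro p
    rw [← integral_sub (hint ha haR p) (hint hb hbR p)]
    exact (integral_inner (hGint p) (a p - b p)).symm
  simp_rw [hinner]
  have hGm : Measurable (fun z : Ω × Ω => G z.1 z.2) := by
    have ha1 : Measurable (fun z : Ω × Ω => a z.1) := ha.comp measurable_fst
    have ha2 : Measurable (fun z : Ω × Ω => a z.2) := ha.comp measurable_snd
    have hb1 : Measurable (fun z : Ω × Ω => b z.1) := hb.comp measurable_fst
    have hb2 : Measurable (fun z : Ω × Ω => b z.2) := hb.comp measurable_snd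
    exact (hH.comp (ha1.sub ha2)).sub (hH.comp (hb1.sub hb2))
  have hu : Measurable (fun p => a p - b p) := ha.sub hb
  have huR : ∀ p, ‖a p - b p‖ ≤ 2 * R := fun p =>
    (norm_sub_le _ _).trans (by linarith [haR p, hbR p])
  have hGC : ∀ p q, ‖G p q‖ ≤ 2 * C := fun p q =>
    (norm_sub_le _ _).trans (by linarith [hbd haR p q, hbd hbR p q])
  have hI1 : Integrable (fun z : Ω × Ω => ⟪a z.1 - b z.1, G z.1 z.2⟫) (P.prod P) := by
    refine Integrable.of_bound
      ((hu.comp measurable_fst).inner hGm).aestronglyMeasurable (2 * R * (2 * C))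
      (ae_of_all _ fun z => (norm_inner_le_norm _ _).trans ?_)
    exact mul_le_mul (huR _) (hGC _ _) (norm_nonneg _) ((norm_nonneg _).trans (huR z.1))
  have hI2 : Integrable (fun z : Ω × Ω => ⟪a z.2 - b z.2, G z.1 z.2⟫) (P.prod P) := by
    refine Integrable.of_bound
      ((hu.comp measurable_snd).inner hGm).aestronglyMeasurable (2 * R * (2 * C))
      (ae_of_all _ fun z => (norm_inner_le_norm _ _).trans ?_)
    exact mul_le_mul (huR _) (hGC _ _) (norm_nonneg _) ((norm_nonneg _).trans (huR z.1))
  have hanti : ∀ p q, G p q = -G q p := by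
    intro p q
    simp only [hG]
    rw [← neg_sub (a q) (a p), ← neg_sub (b q) (b p), hodd, hodd]
    abel
  have hswap : ∫ p, ∫ q, ⟪a p - b p, G p q⟫ ∂P ∂P = -∫ z, ⟪a z.2 - b z.2, G z.1 z.2⟫ ∂P.prod P := by
    rw [integral_integral_swap hI1, ← integral_neg]
    refine Eq.trans ?_ (integral_prod _ hI2.neg).symm
    refine integral_congr_ae (ae_of_all _ fun p => integral_congr_ae (ae_of_all _ fun q => ?_))
    simp only [Pi.neg_apply]
    rw [hanti q p, inner_neg_right]
  have hprod : ∫ p, ∫ q, ⟪a p - b p, G p q⟫ ∂P ∂P = ∫ z, ⟪a z.1 - b z.1, G z.1 z.2⟫ ∂P.prod P :=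
    (integral_prod _ hI1).symm
  have hpos : 0 ≤ ∫ z, (⟪a z.1 - b z.1, G z.1 z.2⟫ - ⟪a z.2 - b z.2, G z.1 z.2⟫) ∂P.prod P := by
    refine integral_nonneg fun z => ?_
    have := hmono (a z.1 - a z.2) (b z.1 - b z.2)
    simp only [Pi.zero_apply]
    rwa [← inner_sub_left, sub_sub_sub_comm]
  rw [integral_sub hI1 hI2] at hpos
  linarith

lemma norm_integral_interaction_le {d : ℕ} {Ω : Type*} [MeasurableSpace Ω] (P : Measure Ω)
    [IsProbabilityMeasure P] {H : Euc d → Euc d} {C R : ℝ}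
    (hC : ∀ x, ‖x‖ ≤ 2 * R → ‖H x‖ ≤ C) {y : Euc d} {a : Ω → Euc d} (hy : ‖y‖ ≤ R)
    (haR : ∀ᵐ q ∂P, ‖a q‖ ≤ R) : ‖∫ q, H (y - a q) ∂P‖ ≤ C := by
  have := norm_integral_le_of_norm_le_const (μ := P) (f := fun q => H (y - a q)) (C := C) (by
    filter_upwards [haR] with q hq
    exact hC _ ((norm_sub_le _ _).trans (by linarith)))
  simpa using this

lemma measurable_integral_interaction {d : ℕ} {Ω : Type*} [MeasurableSpace Ω] (P : Measure Ω)
    [SFinite P] {H : Euc d → Euc d} (hH : Measurable H) {a : ℝ → Ω → Euc d}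
    (ha : Measurable (Function.uncurry a)) :
    Measurable (fun z : ℝ × Ω => ∫ q, H (a z.1 z.2 - a z.1 q) ∂P) := by
  have h : Measurable (fun w : (ℝ × Ω) × Ω => H (a w.1.1 w.1.2 - a w.1.1 w.2)) :=
    hH.comp ((ha.comp measurable_fst).sub
      (ha.comp ((measurable_fst.comp measurable_fst).prodMk measurable_snd)))
  exact h.stronglyMeasurable.integral_prod_right'.measurable

lemma integrable_norm_sub_sq {d : ℕ} {Ω : Type*} [MeasurableSpace Ω] (P : Measure Ω)
    [IsFiniteMeasure P] {R : ℝ} {a b : Ω → Euc d} (ha : Measurable a) (hb : Measurable b)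
    (haR : ∀ p, ‖a p‖ ≤ R) (hbR : ∀ p, ‖b p‖ ≤ R) :
    Integrable (fun p => ‖a p - b p‖ ^ 2) P := by
  refine Integrable.of_bound ((ha.sub hb).norm.pow_const 2).aestronglyMeasurable ((2 * R) ^ 2)
    (ae_of_all _ fun p => ?_)
  rw [norm_pow, norm_norm]
  exact pow_le_pow_left₀ (norm_nonneg _)
    ((norm_sub_le _ _).trans (by linarith [haR p, hbR p])) 2

/-- Two families driven by the same odd monotone interaction contract in `L²`. -/
lemma antitoneOn_integral_norm_sub_sq {d : ℕ} {Ω : Type*} [MeasurableSpace Ω] (P : Measure Ω)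
    [IsProbabilityMeasure P] {H : Euc d → Euc d} (hH : Measurable H)
    (hodd : ∀ x, H (-x) = -H x) (hmono : ∀ x y, 0 ≤ ⟪x - y, H x - H y⟫) {C R : ℝ}
    (hC : ∀ x, ‖x‖ ≤ 2 * R → ‖H x‖ ≤ C) {a b : ℝ → Ω → Euc d}
    (ha : Measurable (Function.uncurry a)) (hb : Measurable (Function.uncurry b))
    (haR : ∀ t p, ‖a t p‖ ≤ R) (hbR : ∀ t p, ‖b t p‖ ≤ R)
    (hae : ∀ᵐ p ∂P, ∀ s t, 0 ≤ s → s ≤ t →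
      a t p = a s p - ∫ r in s..t, ∫ q, H (a r p - a r q) ∂P)
    (hbe : ∀ᵐ p ∂P, ∀ s t, 0 ≤ s → s ≤ t →
      b t p = b s p - ∫ r in s..t, ∫ q, H (b r p - b r q) ∂P) :
    AntitoneOn (fun t => ∫ p, ‖a t p - b t p‖ ^ 2 ∂P) (Ici 0) := by
  refine antitoneOn_Ici_of_sub_le_sq (K := 8 * C ^ 2) fun s t hs hst => ?_
  have ham : ∀ r, Measurable (a r) := fun r => ha.comp measurable_prodMk_left
  have hbm : ∀ r, Measurable (b r) := fun r => hb.comp measurable_prodMk_left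
  set va : ℝ → Ω → Euc d := fun r p => ∫ q, H (a r p - a r q) ∂P with hva
  set vb : ℝ → Ω → Euc d := fun r p => ∫ q, H (b r p - b r q) ∂P with hvb
  have hvam : Measurable (fun z : ℝ × Ω => va z.1 z.2) := measurable_integral_interaction P hH ha
  have hvbm : Measurable (fun z : ℝ × Ω => vb z.1 z.2) := measurable_integral_interaction P hH hb
  have hvaC : ∀ r p, ‖va r p‖ ≤ C := fun r p =>
    norm_integral_interaction_le P hC (haR r p) (ae_of_all _ (haR r))
  have hvbC : ∀ r p, ‖vb r p‖ ≤ C := fun r p =>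
    norm_integral_interaction_le P hC (hbR r p) (ae_of_all _ (hbR r))
  set u : ℝ → Ω → Euc d := fun r p => a r p - b r p with hu
  set D : ℝ → Ω → Euc d := fun r p => va r p - vb r p with hD
  have hum : Measurable (fun z : ℝ × Ω => u z.1 z.2) := ha.sub hb
  have hDm : Measurable (fun z : ℝ × Ω => D z.1 z.2) := hvam.sub hvbm
  have hDC : ∀ r p, ‖D r p‖ ≤ 2 * C := fun r p =>
    (norm_sub_le _ _).trans (by linarith [hvaC r p, hvbC r p])
  have huR : ∀ r p, ‖u r p‖ ≤ 2 * R := fun r p =>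
    (norm_sub_le _ _).trans (by linarith [haR r p, hbR r p])
  have hii : ∀ {v : ℝ → Ω → Euc d} {K : ℝ}, Measurable (fun z : ℝ × Ω => v z.1 z.2) →
      (∀ r p, ‖v r p‖ ≤ K) → ∀ p x y, IntervalIntegrable (fun r => v r p) volume x y := by
    intro v K hvm hvK p x y
    rw [intervalIntegrable_iff, uIoc]
    exact Integrable.of_bound (hvm.comp measurable_prodMk_right).aestronglyMeasurable K
      (ae_of_all _ fun r => hvK r p)
  have huD : ∀ᵐ p ∂P, ∀ x y, 0 ≤ x → x ≤ y → u y p - u x p = -∫ r in x..y, D r p := by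
    filter_upwards [hae, hbe] with p hap hbp x y hx hxy
    simp only [hu, hD]
    rw [intervalIntegral.integral_sub (hii hvam hvaC p x y) (hii hvbm hvbC p x y),
      hap x y hx hxy, hbp x y hx hxy]
    abel
  have hinner : Integrable (fun z : ℝ × Ω => ⟪u z.1 z.2, D z.1 z.2⟫)
      ((volume.restrict (Ioc s t)).prod P) := by
    refine Integrable.of_bound (hum.inner hDm).aestronglyMeasurable (2 * R * (2 * C))
      (ae_of_all _ fun z => (norm_inner_le_norm _ _).trans ?_)
    exact mul_le_mul (huR _ _) (hDC _ _) (norm_nonneg _) ((norm_nonneg _).trans (huR z.1 z.2))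
  have hpt : ∀ᵐ p ∂P, ‖u t p‖ ^ 2 - ‖u s p‖ ^ 2
      ≤ -2 * (∫ r in Ioc s t, ⟪u r p, D r p⟫) + 8 * C ^ 2 * (t - s) ^ 2 := by
    filter_upwards [huD] with p hp
    have hC0 : 0 ≤ 2 * C := (norm_nonneg _).trans (hDC 0 p)
    have h1 : ‖u t p‖ ^ 2 - ‖u s p‖ ^ 2 ≤ 2 * ⟪u t p, u t p - u s p⟫ := by
      have e := norm_sub_sq_real (u t p) (u t p - u s p)
      rw [sub_sub_cancel] at e
      nlinarith [sq_nonneg ‖u t p - u s p‖]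
    have hDi : IntegrableOn (fun r => D r p) (Ioc s t) :=
      (intervalIntegrable_iff_integrableOn_Ioc_of_le hst).1 (hii hDm hDC p s t)
    have h2 : ⟪u t p, u t p - u s p⟫ = -∫ r in Ioc s t, ⟪u t p, D r p⟫ := by
      rw [hp s t hs hst, inner_neg_right, intervalIntegral.integral_of_le hst,
        ← integral_inner hDi]
    have hui : IntegrableOn (fun r => ⟪u r p, D r p⟫) (Ioc s t) := by
      refine Integrable.of_bound ((hum.comp measurable_prodMk_right).inner
        (hDm.comp measurable_prodMk_right)).aestronglyMeasurable (2 * R * (2 * C))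
        (ae_of_all _ fun r => (norm_inner_le_norm _ _).trans ?_)
      exact mul_le_mul (huR _ _) (hDC _ _) (norm_nonneg _) ((norm_nonneg _).trans (huR r p))
    have h3 : ∫ r in Ioc s t, (⟪u r p, D r p⟫ - 4 * C ^ 2 * (t - s))
        ≤ ∫ r in Ioc s t, ⟪u t p, D r p⟫ := by
      refine setIntegral_mono_on (hui.sub (integrable_const _)) (hDi.const_inner _)
        measurableSet_Ioc fun r hr => ?_
      have hL : ‖u t p - u r p‖ ≤ 2 * C * (t - s) := by
        rw [hp r t (hs.trans hr.1.le) hr.2, norm_neg]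
        refine (intervalIntegral.norm_integral_le_of_norm_le_const fun x _ => hDC x p).trans ?_
        rw [abs_of_nonneg (by linarith [hr.2])]
        exact mul_le_mul_of_nonneg_left (by linarith [hr.1]) hC0
      have h4 : |⟪u t p - u r p, D r p⟫| ≤ 2 * C * (t - s) * (2 * C) :=
        (abs_real_inner_le_norm _ _).trans
          (mul_le_mul hL (hDC r p) (norm_nonneg _) ((norm_nonneg _).trans hL))
      rw [inner_sub_left] at h4
      nlinarith [neg_abs_le (⟪u t p, D r p⟫ - ⟪u r p, D r p⟫)]
    rw [integral_sub hui (integrable_const _)] at h3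
    simp only [integral_const, MeasurableSet.univ, measureReal_restrict_apply, univ_inter,
      Real.volume_real_Ioc_of_le hst, smul_eq_mul] at h3
    rw [h2] at h1
    nlinarith
  have hEt := integrable_norm_sub_sq P (ham t) (hbm t) (haR t) (hbR t)
  have hEs := integrable_norm_sub_sq P (ham s) (hbm s) (haR s) (hbR s)
  have hflux : 0 ≤ ∫ p, (∫ r in Ioc s t, ⟪u r p, D r p⟫) ∂P := by
    rw [← integral_integral_swap hinner]
    exact integral_nonneg fun r => integral_inner_interaction_nonneg P hH hodd hmono hC
      (ham r) (hbm r) (haR r) (hbR r)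
  rw [← integral_sub hEt hEs]
  have hfi : Integrable (fun p => ∫ r in Ioc s t, ⟪u r p, D r p⟫) P := hinner.integral_prod_right
  calc ∫ p, (‖u t p‖ ^ 2 - ‖u s p‖ ^ 2) ∂P
      ≤ ∫ p, (-2 * (∫ r in Ioc s t, ⟪u r p, D r p⟫) + 8 * C ^ 2 * (t - s) ^ 2) ∂P :=
        integral_mono_ae (hEt.sub hEs) ((hfi.const_mul _).add (integrable_const _)) hpt
    _ = -2 * (∫ p, (∫ r in Ioc s t, ⟪u r p, D r p⟫) ∂P) + 8 * C ^ 2 * (t - s) ^ 2 := by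
        rw [integral_add (hfi.const_mul _) (integrable_const _), integral_const_mul]
        simp
    _ ≤ 8 * C ^ 2 * (t - s) ^ 2 := by linarith

/-- A solution of an integral equation is continuous at positive times except possibly at the
time after which the integral takes its default value because integrability fails. -/
lemma exists_forall_ne_continuousAt {d : ℕ} {f v : ℝ → Euc d} {x : Euc d}
    (hf : ∀ t, 0 ≤ t → f t = x - ∫ s in (0 : ℝ)..t, v s) :
    ∃ T : ℝ, ∀ s, 0 < s → s ≠ T → ContinuousAt f s := by
  set A : Set ℝ := {t | 0 ≤ t ∧ ¬IntervalIntegrable v volume 0 t} with hA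
  refine ⟨sInf A, fun s hs hsT => ?_⟩
  by_cases hlt : ∃ t ∈ A, t < s
  · obtain ⟨t, ⟨ht0, htn⟩, hts⟩ := hlt
    refine (continuousAt_const (y := x)).congr ?_
    filter_upwards [Ioi_mem_nhds hts] with r hr
    have hr' : t < r := hr
    have hn : ¬IntervalIntegrable v volume 0 r := fun h => htn <|
      h.mono_set (uIcc_subset_uIcc_left (by
        rw [uIcc_of_le (ht0.trans hr'.le)]
        exact ⟨ht0, hr'.le⟩))
    rw [hf r (ht0.trans hr'.le), intervalIntegral.integral_undef hn, sub_zero]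
  · push Not at hlt
    obtain ⟨r, hsr, hr⟩ : ∃ r, s < r ∧ IntervalIntegrable v volume 0 r := by
      by_cases hne : A.Nonempty
      · have h1 : s < sInf A := lt_of_le_of_ne (le_csInf hne hlt) hsT
        refine ⟨(s + sInf A) / 2, by linarith, ?_⟩
        have h2 : (s + sInf A) / 2 ∉ A :=
          notMem_of_lt_csInf (by linarith) ⟨0, fun t ht => ht.1⟩
        by_contra h3
        exact h2 ⟨by linarith, h3⟩
      · refine ⟨s + 1, by linarith, ?_⟩
        by_contra h3
        exact hne ⟨s + 1, by linarith, h3⟩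
    have hr0 : 0 ≤ r := (hs.trans hsr).le
    have hc : ContinuousOn (fun t => x - ∫ s in (0 : ℝ)..t, v s) (Icc 0 r) := by
      refine continuousOn_const.sub ?_
      have := intervalIntegral.continuousOn_primitive_interval (μ := volume) (f := v) (a := 0)
        (b := r) ((intervalIntegrable_iff' (by finiteness)).1 hr)
      rwa [uIcc_of_le hr0] at this
    have hmem : Icc 0 r ∈ nhds s := Icc_mem_nhds hs hsr
    refine (hc.continuousAt hmem).congr ?_
    filter_upwards [hmem] with t ht
    exact (hf t ht.1).symm

/-- A family of measurable maps whose trajectories are continuous off one time each agrees,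
off those times, with a jointly measurable family. -/
lemma exists_measurable_uncurry_eq {d : ℕ} {Z : ℝ → Euc d → Euc d} (hZm : ∀ t, Measurable (Z t))
    {S : Set (Euc d)} {T : Euc d → ℝ}
    (hT : ∀ x ∈ S, ∀ s, 0 < s → s ≠ T x → ContinuousAt (fun t => Z t x) s) :
    ∃ L : ℝ → Euc d → Euc d, Measurable (Function.uncurry L) ∧
      ∀ x ∈ S, ∀ s, 0 < s → s ≠ T x → L s x = Z s x := by
  set F : ℕ → ℝ × Euc d → Euc d :=
    fun n p => Z ((⌊p.1 * ((n : ℝ) + 1)⌋₊ : ℝ) / ((n : ℝ) + 1)) p.2 with hF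
  have hFm : ∀ n, Measurable (F n) := by
    intro n
    have h1 : Measurable (fun q : ℕ × Euc d => Z ((q.1 : ℝ) / ((n : ℝ) + 1)) q.2) :=
      measurable_from_prod_countable_right fun k => hZm ((k : ℝ) / ((n : ℝ) + 1))
    have h2 : Measurable (fun p : ℝ × Euc d => (⌊p.1 * ((n : ℝ) + 1)⌋₊, p.2)) :=
      (Nat.measurable_floor.comp (measurable_fst.mul_const _)).prodMk measurable_snd
    exact h1.comp h2
  refine ⟨fun s x => Filter.limUnder Filter.atTop fun n => F n (s, x), ?_, fun x hx s hs hsT => ?_⟩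
  · exact (StronglyMeasurable.limUnder fun n => (hFm n).stronglyMeasurable).measurable
  · refine Filter.Tendsto.limUnder_eq ?_
    have h1 : Filter.Tendsto (fun n : ℕ => (n : ℝ) + 1) Filter.atTop Filter.atTop :=
      Filter.tendsto_atTop_add_const_right _ _ tendsto_natCast_atTop_atTop
    have h2 := (tendsto_nat_floor_mul_div_atTop hs.le).comp h1
    exact (hT x hx s hs hsT).tendsto.comp h2

/-- The velocity along a bounded trajectory of a characteristic flow is integrable in time. -/
lemma IsCharFlow.intervalIntegrable {d : ℕ} {W : Euc d → ℝ} {μ : Measure (Euc d)}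
    [IsProbabilityMeasure μ] {Z : ℝ → Euc d → Euc d} (hZ : IsCharFlow W μ Z)
    (hZm : ∀ t, Measurable (Z t)) {C R : ℝ} (hC : ∀ x, ‖x‖ ≤ 2 * R → ‖hatGrad W x‖ ≤ C)
    {S : Set (Euc d)} (hS : MeasurableSet S) (hμS : ∀ᵐ x ∂μ, x ∈ S)
    (hZb : ∀ t, 0 ≤ t → ∀ x ∈ S, ‖Z t x‖ ≤ R) {x : Euc d} (hx : x ∈ S) {t : ℝ} (ht : 0 ≤ t) :
    IntervalIntegrable (fun s => ∫ x', hatGrad W (Z s x - Z s x') ∂μ) volume 0 t := by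
  choose T hT using fun y => exists_forall_ne_continuousAt (fun t ht => hZ.2 t ht y)
  obtain ⟨L, hLm, hL⟩ := exists_measurable_uncurry_eq hZm (S := S) (T := T) fun y _ => hT y
  have hLs : ∀ s, Measurable (L s) := fun s => hLm.comp measurable_prodMk_left
  set B : ℝ → Set (Euc d) := fun s => {y | 0 < s ∧ y ∈ S ∧ L s y ≠ Z s y} with hB
  have hBm : ∀ s, MeasurableSet (B s) := fun s =>
    (MeasurableSet.const _).inter (hS.inter (measurableSet_eq_fun (hLs s) (hZm s)).compl)
  have hBT : ∀ s, ∀ y ∈ B s, s = T y := fun s y hy => by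
    by_contra h
    exact hy.2.2 (hL y hy.2.1 s hy.1 h)
  have hBd : Pairwise (Function.onFun Disjoint B) := by
    intro s r hsr
    refine Set.disjoint_left.2 fun y hys hyr => hsr ?_
    rw [hBT s y hys, hBT r y hyr]
  have hcount : Set.Countable {s : ℝ | 0 < μ (B s)} :=
    Measure.countable_meas_pos_of_disjoint_iUnion hBm hBd
  have hwm : Measurable (fun s => ∫ x', hatGrad W (L s x - L s x') ∂μ) :=
    (measurable_integral_interaction μ (measurable_hatGrad W) hLm).comp measurable_prodMk_right
  have heq : (fun s => ∫ x', hatGrad W (L s x - L s x') ∂μ)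
      =ᵐ[volume.restrict (Ioc 0 t)] fun s => ∫ x', hatGrad W (Z s x - Z s x') ∂μ := by
    filter_upwards [ae_restrict_mem measurableSet_Ioc,
      ae_restrict_of_ae (hcount.ae_notMem volume),
      ae_restrict_of_ae ((countable_singleton (T x)).ae_notMem volume)] with s hs hsB hsT
    have hB0 : μ (B s) = 0 := by simpa using hsB
    refine integral_congr_ae ?_
    filter_upwards [hμS, measure_eq_zero_iff_ae_notMem.1 hB0] with y hyS hyB
    have hy : L s y = Z s y := by
      by_contra h
      exact hyB ⟨hs.1, hyS, h⟩
    rw [hy, hL x hx s hs.1 hsT]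
  rw [intervalIntegrable_iff_integrableOn_Ioc_of_le ht]
  refine Integrable.of_bound (hwm.aestronglyMeasurable.congr heq) C ?_
  filter_upwards [ae_restrict_mem measurableSet_Ioc] with s hs
  refine norm_integral_interaction_le μ hC (hZb s hs.1.le x hx) ?_
  filter_upwards [hμS] with y hy using hZb s hs.1.le y hy

/-- A characteristic flow bounded on the support agrees there with a jointly measurable and
globally bounded family solving the same integral equation. -/
lemma IsCharFlow.exists_measurable_uncurry {d : ℕ} {W : Euc d → ℝ} {μ : Measure (Euc d)}
    [IsProbabilityMeasure μ] {Z : ℝ → Euc d → Euc d} (hZ : IsCharFlow W μ Z)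
    (hZm : ∀ t, Measurable (Z t)) {C R : ℝ} (hR : 0 ≤ R)
    (hC : ∀ x, ‖x‖ ≤ 2 * R → ‖hatGrad W x‖ ≤ C)
    {S : Set (Euc d)} (hS : MeasurableSet S) (hμS : ∀ᵐ x ∂μ, x ∈ S)
    (hZb : ∀ t, 0 ≤ t → ∀ x ∈ S, ‖Z t x‖ ≤ R) :
    ∃ Y : ℝ → Euc d → Euc d, Measurable (Function.uncurry Y) ∧ (∀ t x, ‖Y t x‖ ≤ R) ∧
      (∀ t, 0 ≤ t → ∀ x ∈ S, Y t x = Z t x) ∧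
      ∀ x ∈ S, ∀ s t, 0 ≤ s → s ≤ t →
        Y t x = Y s x - ∫ r in s..t, ∫ x', hatGrad W (Y r x - Y r x') ∂μ := by
  have hii := fun {x} (hx : x ∈ S) {t : ℝ} (ht : 0 ≤ t) =>
    hZ.intervalIntegrable hZm hC hS hμS hZb hx ht
  have hYZ : ∀ t, 0 ≤ t → ∀ x ∈ S, S.indicator (Z (max t 0)) x = Z t x := fun t ht x hx => by
    rw [indicator_of_mem hx, max_eq_left ht]
  refine ⟨fun t => S.indicator (Z (max t 0)), ?_, ?_, hYZ, ?_⟩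
  · refine measurable_uncurry_of_continuous_of_measurable (fun x => ?_)
      fun t => (hZm _).indicator hS
    by_cases hx : x ∈ S
    · simp only [indicator_of_mem hx]
      have hc : ContinuousOn (fun t => Z t x) (Ici 0) := by
        intro t ht
        have ht0 : (0 : ℝ) ≤ t := ht
        have h1 := intervalIntegral.continuousOn_primitive_interval (μ := volume)
          (a := 0) (b := t + 1) ((intervalIntegrable_iff' (by finiteness)).1 (hii hx (by linarith : 0 ≤ t + 1)))
        rw [uIcc_of_le (by linarith)] at h1
        have h2 : ContinuousOn (fun t => Z t x) (Icc 0 (t + 1)) :=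
          (continuousOn_const.sub h1).congr fun r hr => hZ.2 r hr.1 x
        refine (h2 t ⟨ht0, by linarith⟩).mono_of_mem_nhdsWithin ?_
        rw [← Ici_inter_Iic]
        exact Filter.inter_mem self_mem_nhdsWithin
          (mem_nhdsWithin_of_mem_nhds (Iic_mem_nhds (by linarith)))
      exact hc.comp_continuous (continuous_id.max continuous_const) fun t => mem_Ici.2 (le_max_right _ _)
    · simp only [indicator_of_notMem hx]
      exact continuous_const
  · intro t x
    beta_reduce
    by_cases hx : x ∈ S
    · rw [indicator_of_mem hx]
      exact hZb _ (le_max_right _ _) x hx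
    · rw [indicator_of_notMem hx, norm_zero]
      exact hR
  · intro x hx s t hs hst
    have ht := hs.trans hst
    have hcongr : ∫ r in s..t, ∫ x', hatGrad W
          (S.indicator (Z (max r 0)) x - S.indicator (Z (max r 0)) x') ∂μ
        = ∫ r in s..t, ∫ x', hatGrad W (Z r x - Z r x') ∂μ := by
      refine intervalIntegral.integral_congr fun r hr => ?_
      rw [uIcc_of_le hst] at hr
      have hr0 := hs.trans hr.1
      refine integral_congr_ae ?_
      filter_upwards [hμS] with y hy
      rw [hYZ r hr0 x hx, hYZ r hr0 y hy]
    simp only [hcongr, hYZ s hs x hx, hYZ t ht x hx]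
    rw [hZ.2 t ht x, hZ.2 s hs x,
      ← intervalIntegral.integral_interval_sub_left (hii hx ht) (hii hx hs)]
    abel

lemma antitoneOn_integral_norm_sub_sq_of_coupling {d : ℕ} {W : Euc d → ℝ}
    (hW : ConvexOn ℝ univ W) (hsymm : ∀ x, W (-x) = W x)
    (hdiff : ∀ x, x ≠ 0 → DifferentiableAt ℝ W x) {μ μ' : Measure (Euc d)}
    [IsProbabilityMeasure μ] [IsProbabilityMeasure μ'] {Z Z' : ℝ → Euc d → Euc d}
    (hZ : IsCharFlow W μ Z) (hZ' : IsCharFlow W μ' Z') (hZm : ∀ t, Measurable (Z t))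
    (hZ'm : ∀ t, Measurable (Z' t)) {R : ℝ} (hR : 0 ≤ R)
    (hZb : ∀ t : ℝ, 0 ≤ t → ∀ x ∈ msupport μ, ‖Z t x‖ ≤ R)
    (hZ'b : ∀ t : ℝ, 0 ≤ t → ∀ y ∈ msupport μ', ‖Z' t y‖ ≤ R)
    (hS : MeasurableSet (msupport μ)) (hS' : MeasurableSet (msupport μ'))
    {γ : Measure (Euc d × Euc d)} (hγ : IsCoupling γ μ μ') :
    AntitoneOn (fun t => ∫ p, ‖Z t p.1 - Z' t p.2‖ ^ 2 ∂γ) (Set.Ici 0) := by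
  obtain ⟨hγp, hγ1, hγ2⟩ := hγ
  obtain ⟨C, -, hC⟩ := exists_norm_hatGrad_le hW hsymm hdiff (2 * R)
  obtain ⟨Y, hYm, hYR, hYZ, hYe⟩ :=
    hZ.exists_measurable_uncurry hZm hR hC hS (ae_mem_msupport μ) hZb
  obtain ⟨Y', hY'm, hY'R, hYZ', hY'e⟩ :=
    hZ'.exists_measurable_uncurry hZ'm hR hC hS' (ae_mem_msupport μ') hZ'b
  have h1 : ∀ᵐ p ∂γ, p.1 ∈ msupport μ := by
    refine ae_of_ae_map (p := fun x => x ∈ msupport μ) measurable_fst.aemeasurable ?_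
    rw [hγ1]
    exact ae_mem_msupport μ
  have h2 : ∀ᵐ p ∂γ, p.2 ∈ msupport μ' := by
    refine ae_of_ae_map (p := fun x => x ∈ msupport μ') measurable_snd.aemeasurable ?_
    rw [hγ2]
    exact ae_mem_msupport μ'
  have hm : ∀ {V : ℝ → Euc d → Euc d}, Measurable (Function.uncurry V) → ∀ (x : Euc d) (r : ℝ),
      Measurable (fun y => hatGrad W (V r x - V r y)) := fun hV x r =>
    (measurable_hatGrad W).comp (measurable_const.sub (hV.comp measurable_prodMk_left))
  have hanti := antitoneOn_integral_norm_sub_sq γ (measurable_hatGrad W) (hatGrad_neg hsymm)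
    (inner_hatGrad_sub_nonneg hW hsymm hdiff) hC
    (a := fun t p => Y t p.1) (b := fun t p => Y' t p.2)
    (hYm.comp (measurable_fst.prodMk (measurable_fst.comp measurable_snd)))
    (hY'm.comp (measurable_fst.prodMk (measurable_snd.comp measurable_snd)))
    (fun t p => hYR t p.1) (fun t p => hY'R t p.2)
    (by
      filter_upwards [h1] with p hp s t hs hst
      rw [hYe p.1 hp s t hs hst]
      congr 2
      ext1 r
      conv_lhs => rw [← hγ1]
      exact integral_map measurable_fst.aemeasurable (hm hYm p.1 r).aestronglyMeasurable)
    (by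
      filter_upwards [h2] with p hp s t hs hst
      rw [hY'e p.2 hp s t hs hst]
      congr 2
      ext1 r
      conv_lhs => rw [← hγ2]
      exact integral_map measurable_snd.aemeasurable (hm hY'm p.2 r).aestronglyMeasurable)
  refine hanti.congr fun t ht => ?_
  refine integral_congr_ae ?_
  filter_upwards [h1, h2] with p hp1 hp2
  rw [hYZ t ht p.1 hp1, hYZ' t ht p.2 hp2]

/-- If a pair of maps does not increase the cost of any coupling, then it does not increase
the Wasserstein distance. -/
lemma wDist_map_le {d : ℕ} {μ ν : Measure (Euc d)} {f g : Euc d → Euc d} (hf : Measurable f)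
    (hg : Measurable g) (hne : ∃ γ, IsCoupling γ μ ν)
    (h : ∀ γ, IsCoupling γ μ ν →
      ∫ p, ‖f p.1 - g p.2‖ ^ 2 ∂γ ≤ ∫ p, ‖p.1 - p.2‖ ^ 2 ∂γ) :
    wDist (μ.map f) (ν.map g) ≤ wDist μ ν := by
  refine Real.sqrt_le_sqrt ?_
  obtain ⟨γ₀, hγ₀⟩ := hne
  refine le_csInf ⟨_, γ₀, hγ₀, rfl⟩ ?_
  rintro r ⟨γ, hγ, rfl⟩
  refine le_trans (csInf_le ⟨0, ?_⟩ ⟨γ.map (Prod.map f g), ⟨?_, ?_, ?_⟩, rfl⟩) (le_trans ?_ (h γ hγ))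
  · rintro _ ⟨γ', -, rfl⟩
    exact integral_nonneg fun p => by positivity
  · have := hγ.1
    exact Measure.isProbabilityMeasure_map (hf.prodMap hg).aemeasurable
  · rw [Measure.map_map measurable_fst (hf.prodMap hg), ← hγ.2.1,
      Measure.map_map hf measurable_fst]
    rfl
  · rw [Measure.map_map measurable_snd (hf.prodMap hg), ← hγ.2.2,
      Measure.map_map hg measurable_snd]
    rfl
  · have hm : Measurable (fun p : Euc d × Euc d => ‖p.1 - p.2‖ ^ 2) :=
      (measurable_fst.sub measurable_snd).norm.pow_const 2
    rw [integral_map (hf.prodMap hg).aemeasurable hm.aestronglyMeasurable]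
    rfl

/-- For a strictly `λ`-convex potential (`λ > 0`) and uniformly bounded flows, the coupled
squared displacement is non-increasing in time, and the Wasserstein distance between the
pushforwards does not exceed the initial one. -/
theorem stmt3 {d : ℕ} (hd : 1 ≤ d) (W : Euc d → ℝ) (lam : ℝ) (hlam : 0 < lam)
    (hsymm : ∀ x : Euc d, W (-x) = W x) (hW0 : W 0 = 0)
    (hC1 : ContDiffOn ℝ 1 W {(0 : Euc d)}ᶜ)
    (hconv : ConvexOn ℝ Set.univ (fun x : Euc d => W x - lam / 2 * ‖x‖ ^ 2))
    (μ μ' : Measure (Euc d)) [IsProbabilityMeasure μ] [IsProbabilityMeasure μ']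
    (hcpt : IsCompact (msupport μ)) (hcpt' : IsCompact (msupport μ'))
    (Z Z' : ℝ → Euc d → Euc d)
    (hZ : IsCharFlow W μ Z) (hZ' : IsCharFlow W μ' Z')
    (hZm : ∀ t, Measurable (Z t)) (hZ'm : ∀ t, Measurable (Z' t))
    (R : ℝ) (hR : 0 ≤ R)
    (hZb : ∀ t : ℝ, 0 ≤ t → ∀ x ∈ msupport μ, ‖Z t x‖ ≤ R)
    (hZ'b : ∀ t : ℝ, 0 ≤ t → ∀ y ∈ msupport μ', ‖Z' t y‖ ≤ R)
    (γ : Measure (Euc d × Euc d)) (hγ : IsCoupling γ μ μ') :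
    AntitoneOn (fun t => ∫ p, ‖Z t p.1 - Z' t p.2‖ ^ 2 ∂γ) (Set.Ici 0) ∧
    (∀ t : ℝ, 0 ≤ t →
      ∫ p, ‖Z t p.1 - Z' t p.2‖ ^ 2 ∂γ ≤ ∫ p, ‖p.1 - p.2‖ ^ 2 ∂γ) ∧
    (∀ t : ℝ, 0 ≤ t →
      wDist (μ.map (Z t)) (μ'.map (Z' t)) ≤ wDist μ μ') := by
  have hW : ConvexOn ℝ univ W := by
    have hsq : ConvexOn ℝ univ (fun x : Euc d => lam / 2 * ‖x‖ ^ 2) :=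
      ((convexOn_norm convex_univ).pow (fun x _ => norm_nonneg x) 2).smul (by positivity)
    have hsum := hconv.add hsq
    have e : ((fun x : Euc d => W x - lam / 2 * ‖x‖ ^ 2) + fun x => lam / 2 * ‖x‖ ^ 2) = W := by
      ext x
      simp
    rwa [e] at hsum
  have hdiff : ∀ x, x ≠ 0 → DifferentiableAt ℝ W x := fun x hx =>
    (hC1.contDiffAt (isOpen_compl_singleton.mem_nhds hx)).differentiableAt one_ne_zero
  have hanti : ∀ γ, IsCoupling γ μ μ' →
      AntitoneOn (fun t => ∫ p, ‖Z t p.1 - Z' t p.2‖ ^ 2 ∂γ) (Set.Ici 0) := fun γ hγ =>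
    antitoneOn_integral_norm_sub_sq_of_coupling hW hsymm hdiff hZ hZ' hZm hZ'm hR hZb hZ'b
      hcpt.measurableSet hcpt'.measurableSet hγ
  have hle : ∀ γ, IsCoupling γ μ μ' → ∀ t : ℝ, 0 ≤ t →
      ∫ p, ‖Z t p.1 - Z' t p.2‖ ^ 2 ∂γ ≤ ∫ p, ‖p.1 - p.2‖ ^ 2 ∂γ := fun γ hγ t ht => by
    have h := hanti γ hγ self_mem_Ici ht ht
    simpa only [hZ.1, hZ'.1] using h
  exact ⟨hanti γ hγ, hle γ hγ, fun t ht =>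
    wDist_map_le (hZm t) (hZ'm t) ⟨γ, hγ⟩ fun γ' hγ' => hle γ' hγ' t ht⟩
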